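/- Let (N, E) be a connected undirected graph on N ≥ 2 nodes with Laplacian matrix W ∈ ℝ^{N×N}, let λ⁺(W) > 0 be its smallest nonzero eigenvalue and λ_max(W) its largest eigenvalue, and let W̄ := W ⊗ I_d. Let f_1,…,f_N : ℝ^d → ℝ be differentiable, μ-strongly convex, with L-Lipschitz gradients (0 < μ ≤ L); for x_i ∈ ℝ^d let c_i(x_i) be the unique minimizer of c ↦ f_i(c) + ⟨c, x_i⟩, and for x = (x_1,…,x_N) ∈ ℝ^{Nd} put c(x) := (c_1(x_1),…,c_N(x_N)). Define T(x) := x + γ W̄ c(x) with step size γ = 2Lμ/(μ λ⁺(W) + L λ_max(W)), set X := Im(W̄), κ(W) := λ_max(W) L/(μ λ⁺(W)), and σ := 1 − 2/(κ(W) + 1). Let S be the positive semidefinite square root of W̄ and for x ∈ X define ‖x‖_M := ‖u‖₂, where u is the unique element of Im(S) with S u = x. Then: (i) T(x) ∈ X for every x ∈ X; (ii) T has a unique fixed point x* in X; and (iii) ‖T(x) − x*‖_M ≤ σ ‖x − x*‖_M for all x ∈ X. -/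

import Mathlib

open Matrix
open scoped Kronecker RealInnerProductSpace

/-- The `i`-th `d`-dimensional block of a vector in `ℝ^{Nd}`. -/
noncomputable def blockGet {N d : ℕ} (x : EuclideanSpace ℝ (Fin N × Fin d))
    (i : Fin N) : EuclideanSpace ℝ (Fin d) :=
  (EuclideanSpace.equiv (Fin d) ℝ).symm
    fun j => (EuclideanSpace.equiv (Fin N × Fin d) ℝ) x (i, j)

/-- Assemble `N` blocks of dimension `d` into a vector in `ℝ^{Nd}`. -/
noncomputable def blockMk {N d : ℕ} (c : Fin N → EuclideanSpace ℝ (Fin d)) :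
    EuclideanSpace ℝ (Fin N × Fin d) :=
  (EuclideanSpace.equiv (Fin N × Fin d) ℝ).symm
    fun p => (EuclideanSpace.equiv (Fin d) ℝ) (c p.1) p.2

section
variable {E : Type*} [NormedAddCommGroup E] [InnerProductSpace ℝ E]

theorem exists_symm_map (q r : E) (b : ℝ) (h : ‖r‖ ≤ b * ‖q‖) (hb : 0 ≤ b) :
    ∃ R : E →ₗ[ℝ] E, (∀ a c, ⟪R a, c⟫ = ⟪a, R c⟫) ∧ R q = r ∧ ∀ z, |⟪R z, z⟫| ≤ b * ‖z‖ ^ 2 := by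
  by_cases hr : r = 0
  · exact ⟨0, by simp, by simp [hr], fun z => by simp; positivity⟩
  have hr' : 0 < ‖r‖ := norm_pos_iff.2 hr
  have hq : 0 < ‖q‖ := by
    rcases (norm_nonneg q).eq_or_lt with h0 | h0
    · rw [← h0] at h; simp at h; exact absurd h hr
    · exact h0
  set β := ‖r‖ / ‖q‖ with hβ
  have hβ0 : 0 < β := by positivity
  have hβb : β ≤ b := by rw [hβ, div_le_iff₀ hq]; exact h
  have hn : ‖q‖ = ‖β⁻¹ • r‖ := by
    rw [norm_smul, Real.norm_of_nonneg (by positivity), hβ]; field_simp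
  let F := (Submodule.span ℝ {q - β⁻¹ • r})ᗮ.reflection
  refine ⟨β • F.toLinearEquiv.toLinearMap, ?_, ?_, ?_⟩
  · intro a c
    have : ⟪F a, c⟫ = ⟪a, F c⟫ := by
      rw [← F.inner_map_map (F a) c]; simp [F]
    simp [inner_smul_left, inner_smul_right, this]
  · have : F q = β⁻¹ • r := Submodule.reflection_sub hn
    simp [this, smul_smul, hβ0.ne']
  · intro z
    have : |⟪F z, z⟫| ≤ ‖z‖ * ‖z‖ := by
      simpa using abs_real_inner_le_norm (F z) z
    simp only [LinearMap.smul_apply, inner_smul_left]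
    have h2 : |β * ⟪F z, z⟫| ≤ b * (‖z‖ * ‖z‖) := by
      rw [abs_mul, abs_of_pos hβ0]; gcongr
    simpa [sq] using h2

theorem symm_bound (K : E →ₗ[ℝ] E) (U : Submodule ℝ E) (hK : ∀ a c, ⟪K a, c⟫ = ⟪a, K c⟫)
    (hU : ∀ a ∈ U, K a ∈ U) (s : ℝ) (hs : ∀ a ∈ U, |⟪K a, a⟫| ≤ s * ‖a‖ ^ 2) (hs0 : 0 ≤ s)
    (w : E) (hw : w ∈ U) : ‖K w‖ ≤ s * ‖w‖ := by
  by_cases h0 : K w = 0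
  · rw [h0]; simp; positivity
  have h0' : 0 < ‖K w‖ := norm_pos_iff.2 h0
  have hw0 : 0 < ‖w‖ := by
    rw [norm_pos_iff]; rintro rfl; simp at h0
  set t := ‖w‖ / ‖K w‖ with ht
  have htK : t * ‖K w‖ = ‖w‖ := by rw [ht]; field_simp
  have hz : t • K w ∈ U := U.smul_mem _ (hU _ hw)
  have h1 := (abs_le.1 (hs _ (U.add_mem hw hz))).2
  have h2 := (abs_le.1 (hs _ (U.sub_mem hw hz))).1
  have hp := parallelogram_law_with_norm ℝ w (t • K w)
  have hzn : ‖t • K w‖ = ‖w‖ := by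
    rw [norm_smul, Real.norm_of_nonneg (by positivity), htK]
  rw [hzn] at hp
  have e : ⟪K (w + t • K w), w + t • K w⟫ - ⟪K (w - t • K w), w - t • K w⟫
      = 4 * (t * ‖K w‖ ^ 2) := by
    have : ⟪K (t • K w), w⟫ = t * ‖K w‖ ^ 2 := by
      rw [hK, inner_smul_left, real_inner_self_eq_norm_sq]; rfl
    have h' : ⟪K w, t • K w⟫ = t * ‖K w‖ ^ 2 := by
      rw [inner_smul_right, real_inner_self_eq_norm_sq]
    rw [map_add, map_sub]
    simp only [inner_add_left, inner_add_right, inner_sub_left, inner_sub_right, this, h']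
    ring
  have e2 : t * ‖K w‖ ^ 2 = ‖w‖ * ‖K w‖ := by rw [← htK]; ring
  have : ‖w‖ * ‖K w‖ ≤ ‖w‖ * (s * ‖w‖) := by nlinarith
  exact le_of_mul_le_mul_left this hw0

variable [CompleteSpace E]

theorem line_hasDerivAt {f : E → ℝ} {g : E → E} (hg : ∀ x, HasGradientAt f (g x) x) (x v : E)
    (t : ℝ) : HasDerivAt (fun t : ℝ => f (x + t • v)) ⟪g (x + t • v), v⟫ t := by
  have h1 : HasDerivAt (fun t : ℝ => x + t • v) v t := by
    simpa using ((hasDerivAt_id t).smul_const v).const_add x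
  have := (hg (x + t • v)).hasFDerivAt.comp_hasDerivAt t h1
  exact this.congr_deriv (by simp)

theorem descent {f : E → ℝ} {g : E → E} (hg : ∀ x, HasGradientAt f (g x) x) (L : ℝ)
    (hL : ∀ x y, ‖g x - g y‖ ≤ L * ‖x - y‖) (x v : E) :
    f (x + v) ≤ f x + ⟪g x, v⟫ + L / 2 * ‖v‖ ^ 2 := by
  have hd : ∀ t : ℝ, HasDerivAt (fun t : ℝ => f (x + t • v) - t * ⟪g x, v⟫ - L / 2 * ‖v‖ ^ 2 * t ^ 2)
      (⟪g (x + t • v), v⟫ - ⟪g x, v⟫ - L / 2 * ‖v‖ ^ 2 * (2 * t)) t := by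
    intro t
    have h1 := line_hasDerivAt hg x v t
    have h2 := (hasDerivAt_id t).mul_const ⟪g x, v⟫
    have h3 := ((hasDerivAt_id t).pow 2).const_mul (L / 2 * ‖v‖ ^ 2)
    exact ((h1.sub h2).sub h3).congr_deriv (by simp)
  have ha := antitoneOn_of_deriv_nonpos (convex_Icc (0:ℝ) 1)
    (fun t _ => (hd t).continuousAt.continuousWithinAt)
    (fun t _ => (hd t).differentiableAt.differentiableWithinAt) (by
      intro t ht
      rw [interior_Icc] at ht
      rw [(hd t).deriv, ← inner_sub_left]
      have h1 := real_inner_le_norm (g (x + t • v) - g x) v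
      have h2 := hL (x + t • v) x
      rw [add_sub_cancel_left, norm_smul, Real.norm_of_nonneg ht.1.le] at h2
      nlinarith [mul_le_mul_of_nonneg_right h2 (norm_nonneg v)])
  have := ha (by simp : (0:ℝ) ∈ Set.Icc (0:ℝ) 1) (by simp : (1:ℝ) ∈ Set.Icc (0:ℝ) 1) zero_le_one
  simp at this
  linarith

theorem first_order {f : E → ℝ} {g : E → E} (hg : ∀ x, HasGradientAt f (g x) x) (μ : ℝ)
    (hc : ConvexOn ℝ Set.univ (fun x => f x - μ / 2 * ‖x‖ ^ 2)) (x v : E) :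
    f x + ⟪g x, v⟫ + μ / 2 * ‖v‖ ^ 2 ≤ f (x + v) := by
  have hd : HasDerivAt (fun t : ℝ => f (x + t • v) - μ / 2 * ‖x + t • v‖ ^ 2)
      (⟪g x, v⟫ - μ * ⟪x, v⟫) 0 := by
    have h1 := line_hasDerivAt hg x v 0
    have h2 : HasDerivAt (fun t : ℝ => ‖x + t • v‖ ^ 2) (2 * ⟪x, v⟫) 0 := by
      have h1 : HasDerivAt (fun t : ℝ => x + t • v) v 0 := by
        simpa using ((hasDerivAt_id (0:ℝ)).smul_const v).const_add x
      simpa using h1.norm_sq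
    exact (h1.sub (h2.const_mul (μ / 2))).congr_deriv (by simp; ring)
  have hc' : ConvexOn ℝ Set.univ (fun t : ℝ => f (x + t • v) - μ / 2 * ‖x + t • v‖ ^ 2) := by
    have := hc.comp_affineMap (AffineMap.lineMap x (x + v) : ℝ →ᵃ[ℝ] E)
    have e : (fun t : ℝ => f (x + t • v) - μ / 2 * ‖x + t • v‖ ^ 2) =
        (fun x => f x - μ / 2 * ‖x‖ ^ 2) ∘ (AffineMap.lineMap x (x + v) : ℝ →ᵃ[ℝ] E) := by
      ext t
      simp [AffineMap.lineMap_apply, add_comm]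
    rw [e]
    exact this
  have := hc'.le_slope_of_hasDerivAt (Set.mem_univ 0) (Set.mem_univ 1) zero_lt_one hd
  simp [slope_def_field] at this
  rw [norm_add_sq_real] at this
  linarith

theorem coco {f : E → ℝ} {g : E → E} (hg : ∀ x, HasGradientAt f (g x) x) (μ L : ℝ)
    (hμ : 0 < μ) (hμL : μ ≤ L)
    (hc : ConvexOn ℝ Set.univ (fun x => f x - μ / 2 * ‖x‖ ^ 2))
    (hL : ∀ x y, ‖g x - g y‖ ≤ L * ‖x - y‖) (x y : E) :
    ‖g x - g y‖ ^ 2 + L * μ * ‖x - y‖ ^ 2 ≤ (L + μ) * ⟪g x - g y, x - y⟫ := by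
  -- D is the gradient difference of the convex part
  have key : ∀ (t : ℝ) (x y : E), t * ‖(g y - g x) - μ • (y - x)‖ ^ 2
      - (L - μ) * t ^ 2 / 2 * ‖(g y - g x) - μ • (y - x)‖ ^ 2 ≤
      f y - f x - ⟪g x, y - x⟫ - μ / 2 * ‖y - x‖ ^ 2 := by
    intro t x y
    set D := (g y - g x) - μ • (y - x) with hD
    have h1 := first_order hg μ hc x (y - x - t • D)
    have h2 := descent hg L hL y (-(t • D))
    have e : x + (y - x - t • D) = y + -(t • D) := by abel
    rw [e] at h1
    have hn : ‖y - x - t • D‖ ^ 2 = ‖y - x‖ ^ 2 - 2 * (t * ⟪y - x, D⟫) + t ^ 2 * ‖D‖ ^ 2 := by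
      rw [norm_sub_sq_real, inner_smul_right, norm_smul, mul_pow, Real.norm_eq_abs, sq_abs]
    have hn2 : ‖-(t • D)‖ ^ 2 = t ^ 2 * ‖D‖ ^ 2 := by
      rw [norm_neg, norm_smul, mul_pow, Real.norm_eq_abs, sq_abs]
    rw [hn, inner_sub_right, inner_smul_right] at h1
    rw [hn2, inner_neg_right, inner_smul_right] at h2
    have hDD : ⟪g y, D⟫ - ⟪g x, D⟫ - μ * ⟪y - x, D⟫ = ‖D‖ ^ 2 := by
      have h3 : ⟪(g y - g x) - μ • (y - x), D⟫ = ⟪D, D⟫ := by rw [← hD]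
      rw [← real_inner_self_eq_norm_sq, ← h3, inner_sub_left (g y - g x), inner_sub_left (g y),
        inner_smul_left]; rfl
    have h4 : t * (⟪g y, D⟫ - ⟪g x, D⟫ - μ * ⟪y - x, D⟫) = t * ‖D‖ ^ 2 := by rw [hDD]
    linarith
  set D := (g x - g y) - μ • (x - y) with hD
  have hs : ∀ t : ℝ, (2 * t - (L - μ) * t ^ 2) * ‖D‖ ^ 2 ≤ ⟪D, x - y⟫ := by
    intro t
    have h1 := key t y x
    have h2 := key t x y
    have e : (g y - g x) - μ • (y - x) = - D := by rw [hD]; module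
    have e2 : y - x = -(x - y) := by abel
    rw [e, norm_neg, norm_sub_rev y x, e2, inner_neg_right] at h2
    rw [← hD] at h1
    rw [hD, inner_sub_left, inner_smul_left, ← hD, inner_sub_left, real_inner_self_eq_norm_sq]
    simp only [conj_trivial]
    linarith
  have hM : ‖D‖ ^ 2 ≤ (L - μ) * ⟪D, x - y⟫ := by
    rcases hμL.eq_or_lt with h | h
    · subst h
      simp only [sub_self, zero_mul, sub_zero] at hs ⊢
      by_contra hcon
      push Not at hcon
      have := hs ((⟪D, x - y⟫ + 1) / (2 * ‖D‖ ^ 2))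
      rw [show 2 * ((⟪D, x - y⟫ + 1) / (2 * ‖D‖ ^ 2)) * ‖D‖ ^ 2 = ⟪D, x - y⟫ + 1 by
        generalize ‖D‖ ^ 2 = a at hcon
        field_simp] at this
      linarith
    · have hp : 0 < L - μ := by linarith
      have := hs (1 / (L - μ))
      have e : 2 * (1 / (L - μ)) - (L - μ) * (1 / (L - μ)) ^ 2 = 1 / (L - μ) := by
        field_simp; ring
      rw [e, one_div, inv_mul_le_iff₀ hp] at this
      exact this
  have n1 : ‖D‖ ^ 2 = ‖g x - g y‖ ^ 2 - 2 * (μ * ⟪g x - g y, x - y⟫) + μ ^ 2 * ‖x - y‖ ^ 2 := by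
    rw [hD, norm_sub_sq_real, inner_smul_right, norm_smul, mul_pow, Real.norm_eq_abs, sq_abs]
  have n2 : ⟪D, x - y⟫ = ⟪g x - g y, x - y⟫ - μ * ‖x - y‖ ^ 2 := by
    rw [hD, inner_sub_left, inner_smul_left, real_inner_self_eq_norm_sq]; rfl
  rw [n1, n2] at hM
  nlinarith

theorem grad_at_min {f : E → ℝ} {g : E → E} (hg : ∀ x, HasGradientAt f (g x) x) (c x : E)
    (h : ∀ y, f c + ⟪c, x⟫ ≤ f y + ⟪y, x⟫) : g c = -x := by
  have h1 : ∀ v, ⟪g c + x, v⟫ = 0 := by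
    intro v
    have hd : HasDerivAt (fun t : ℝ => f (c + t • v) + (⟪c, x⟫ + t * ⟪v, x⟫)) (⟪g c, v⟫ + ⟪v, x⟫) 0 := by
      have h1 := line_hasDerivAt hg c v 0
      have h2 := ((hasDerivAt_id (0:ℝ)).mul_const ⟪v, x⟫).const_add ⟪c, x⟫
      exact (h1.add h2).congr_deriv (by simp)
    have hm : IsLocalMin (fun t : ℝ => f (c + t • v) + (⟪c, x⟫ + t * ⟪v, x⟫)) 0 := by
      refine Filter.Eventually.of_forall fun t => ?_
      have := h (c + t • v)
      rw [inner_add_left, inner_smul_left] at this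
      simpa using this
    have := hm.hasDerivAt_eq_zero hd
    rw [inner_add_left, real_inner_comm v x]
    exact this
  exact eq_neg_of_add_eq_zero_left (inner_self_eq_zero.1 (h1 (g c + x)))

theorem contr_est (A : E →ₗ[ℝ] E) (hA : ∀ a c, ⟪A a, c⟫ = ⟪a, A c⟫) (C : E → E)
    (μ L lp lm γ σ : ℝ) (hμ : 0 < μ) (hμL : μ ≤ L) (hlp : 0 < lp) (hlm : lp ≤ lm)
    (hC : ∀ x y, ‖x - y‖ ^ 2 + L * μ * ‖C x - C y‖ ^ 2 ≤ - ((L + μ) * ⟪x - y, C x - C y⟫))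
    (h1 : ∀ v ∈ LinearMap.range A, lp * ‖v‖ ^ 2 ≤ ‖A v‖ ^ 2)
    (h2 : ∀ v ∈ LinearMap.range A, ‖A v‖ ^ 2 ≤ lm * ‖v‖ ^ 2)
    (hγ : γ = 2 * L * μ / (μ * lp + L * lm))
    (hσ : σ = (L * lm - μ * lp) / (μ * lp + L * lm))
    (w w' : E) (hw : w ∈ LinearMap.range A) (hw' : w' ∈ LinearMap.range A) :
    ‖(w + γ • A (C (A w))) - (w' + γ • A (C (A w')))‖ ≤ σ * ‖w - w'‖ := by
  have hL : 0 < L := by linarith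
  have hlm0 : 0 < lm := by linarith
  have hden : 0 < μ * lp + L * lm := by positivity
  have hγ0 : 0 < γ := by rw [hγ]; positivity
  have hσ0 : 0 ≤ σ := by
    rw [hσ]
    apply div_nonneg _ hden.le
    nlinarith [mul_le_mul hμL hlm hlp.le hL.le]
  set q := A w - A w' with hq
  set p := C (A w) - C (A w') with hp
  have hc := hC (A w) (A w')
  rw [← hq, ← hp] at hc
  set a := (1 / μ + 1 / L) / 2 with ha
  set b := (1 / μ - 1 / L) / 2 with hb
  have hb0 : 0 ≤ b := by
    have := one_div_le_one_div_of_le hμ hμL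
    rw [hb]; linarith
  have hr : ‖-p - a • q‖ ≤ b * ‖q‖ := by
    apply le_of_sq_le_sq _ (by positivity)
    have e : ‖-p - a • q‖ ^ 2 = ‖p‖ ^ 2 + 2 * a * ⟪q, p⟫ + a ^ 2 * ‖q‖ ^ 2 := by
      rw [norm_sub_sq_real, inner_smul_right, norm_smul, mul_pow, Real.norm_eq_abs, sq_abs,
        norm_neg, inner_neg_left, real_inner_comm]; ring
    rw [e, mul_pow]
    have e2 : (‖p‖ ^ 2 + 2 * a * ⟪q, p⟫ + a ^ 2 * ‖q‖ ^ 2) - b ^ 2 * ‖q‖ ^ 2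
        = 1 / (L * μ) * (‖q‖ ^ 2 + L * μ * ‖p‖ ^ 2 + (L + μ) * ⟪q, p⟫) := by
      rw [ha, hb]; field_simp; ring
    have : 1 / (L * μ) * (‖q‖ ^ 2 + L * μ * ‖p‖ ^ 2 + (L + μ) * ⟪q, p⟫) ≤ 0 :=
      mul_nonpos_of_nonneg_of_nonpos (by positivity) (by linarith)
    linarith
  obtain ⟨R, hRs, hRq, hRb⟩ := exists_symm_map q _ b hr hb0
  let K : E →ₗ[ℝ] E := LinearMap.id - γ • (A ∘ₗ (a • LinearMap.id + R) ∘ₗ A)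
  have hKv : ∀ v, K v = v - γ • A (a • A v + R (A v)) := fun v => rfl
  have hK : ∀ c d, ⟪K c, d⟫ = ⟪c, K d⟫ := by
    intro c d
    rw [hKv, hKv]
    simp only [inner_sub_left, inner_sub_right, inner_smul_left, inner_smul_right, hA, map_add,
      map_smul, inner_add_left, inner_add_right, hRs, conj_trivial]
  have hKw : K (w - w') = (w + γ • A (C (A w))) - (w' + γ • A (C (A w'))) := by
    rw [hKv, map_sub, ← hq, hRq]
    have : a • q + (-p - a • q) = -p := by abel
    rw [this, hp, map_neg, map_sub]; module
  rw [← hKw]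
  refine symm_bound K (LinearMap.range A) hK ?_ σ ?_ hσ0 _ (Submodule.sub_mem _ hw hw')
  · intro v hv
    rw [hKv]
    exact Submodule.sub_mem _ hv (Submodule.smul_mem _ _ (LinearMap.mem_range_self _ _))
  · intro v hv
    have e : ⟪K v, v⟫ = ‖v‖ ^ 2 - γ * (a * ‖A v‖ ^ 2 + ⟪R (A v), A v⟫) := by
      rw [hKv, inner_sub_left, inner_smul_left, hA, inner_add_left, inner_smul_left,
        real_inner_self_eq_norm_sq, real_inner_self_eq_norm_sq]; rfl
    have hR := abs_le.1 (hRb (A v))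
    have g1 := h1 v hv
    have g2 := h2 v hv
    have k1 : 1 / L * (lp * ‖v‖ ^ 2) ≤ a * ‖A v‖ ^ 2 + ⟪R (A v), A v⟫ := by
      have : 1 / L * (lp * ‖v‖ ^ 2) ≤ 1 / L * ‖A v‖ ^ 2 := by gcongr
      have e : 1 / L * ‖A v‖ ^ 2 = a * ‖A v‖ ^ 2 - b * ‖A v‖ ^ 2 := by rw [ha, hb]; ring
      linarith [hR.1]
    have k2 : a * ‖A v‖ ^ 2 + ⟪R (A v), A v⟫ ≤ 1 / μ * (lm * ‖v‖ ^ 2) := by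
      have : 1 / μ * ‖A v‖ ^ 2 ≤ 1 / μ * (lm * ‖v‖ ^ 2) := by gcongr
      have e : 1 / μ * ‖A v‖ ^ 2 = a * ‖A v‖ ^ 2 + b * ‖A v‖ ^ 2 := by rw [ha, hb]; ring
      linarith [hR.2]
    have s1 : σ * ‖v‖ ^ 2 = ‖v‖ ^ 2 - γ * (1 / L * (lp * ‖v‖ ^ 2)) := by
      rw [hσ, hγ]; field_simp; ring
    have s2 : -(σ * ‖v‖ ^ 2) = ‖v‖ ^ 2 - γ * (1 / μ * (lm * ‖v‖ ^ 2)) := by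
      rw [hσ, hγ]; field_simp; ring
    rw [abs_le, e, s2, s1]
    constructor
    · have := mul_le_mul_of_nonneg_left k2 hγ0.le
      linarith
    · have := mul_le_mul_of_nonneg_left k1 hγ0.le
      linarith

theorem abstract_main [FiniteDimensional ℝ E] (A : E →ₗ[ℝ] E) (hA : ∀ a c, ⟪A a, c⟫ = ⟪a, A c⟫) (C : E → E)
    (μ L lp lm γ σ : ℝ) (hμ : 0 < μ) (hμL : μ ≤ L) (hlp : 0 < lp) (hlm : lp ≤ lm)
    (hC : ∀ x y, ‖x - y‖ ^ 2 + L * μ * ‖C x - C y‖ ^ 2 ≤ - ((L + μ) * ⟪x - y, C x - C y⟫))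
    (h1 : ∀ v ∈ LinearMap.range A, lp * ‖v‖ ^ 2 ≤ ‖A v‖ ^ 2)
    (h2 : ∀ v ∈ LinearMap.range A, ‖A v‖ ^ 2 ≤ lm * ‖v‖ ^ 2)
    (hγ : γ = 2 * L * μ / (μ * lp + L * lm))
    (hσ : σ = (L * lm - μ * lp) / (μ * lp + L * lm))
    (T : E → E) (hT : ∀ x, T x = x + γ • A (A (C x))) (X : Submodule ℝ E)
    (hX : ∀ x, x ∈ X ↔ ∃ v, A (A v) = x) :
    (∀ x ∈ X, T x ∈ X) ∧
    ∃ xstar ∈ X, T xstar = xstar ∧ (∀ y ∈ X, T y = y → y = xstar) ∧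
      (∀ x ∈ X, ∀ u w : E, u ∈ LinearMap.range A → w ∈ LinearMap.range A →
        A u = T x - xstar → A w = x - xstar → ‖u‖ ≤ σ * ‖w‖) := by
  have hest := contr_est A hA C μ L lp lm γ σ hμ hμL hlp hlm hC h1 h2 hγ hσ
  have hL : 0 < L := by linarith
  have hlm0 : 0 < lm := by linarith
  have hden : 0 < μ * lp + L * lm := by positivity
  have hσ0 : 0 ≤ σ := by
    rw [hσ]
    apply div_nonneg _ hden.le
    nlinarith [mul_le_mul hμL hlm hlp.le hL.le]
  have hσ1 : σ < 1 := by
    rw [hσ, div_lt_one hden]; nlinarith [mul_pos hμ hlp]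
  have hinj : ∀ a ∈ LinearMap.range A, ∀ c ∈ LinearMap.range A, A a = A c → a = c := by
    intro a ha c hc h
    have := h1 (a - c) (Submodule.sub_mem _ ha hc)
    rw [map_sub, h, sub_self, norm_zero] at this
    have h0 : ‖a - c‖ ^ 2 ≤ 0 := by nlinarith
    have : ‖a - c‖ = 0 := by nlinarith [norm_nonneg (a - c), sq_nonneg ‖a - c‖]
    exact sub_eq_zero.1 (norm_eq_zero.1 this)
  have hXmem : ∀ v, A (A v) ∈ X := fun v => (hX _).2 ⟨v, rfl⟩
  let F : LinearMap.range A → LinearMap.range A := fun w =>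
    ⟨(w : E) + γ • A (C (A w)), Submodule.add_mem _ w.2
      (Submodule.smul_mem _ _ (LinearMap.mem_range_self _ _))⟩
  have hF : ContractingWith ⟨σ, hσ0⟩ F := by
    refine ⟨by exact_mod_cast hσ1, LipschitzWith.of_dist_le_mul fun w w' => ?_⟩
    have := hest w w' w.2 w'.2
    rw [Subtype.dist_eq, Subtype.dist_eq, dist_eq_norm, dist_eq_norm]
    exact this
  set ws := hF.fixedPoint F with hws
  have hfix : (ws : E) + γ • A (C (A ws)) = ws := congrArg Subtype.val hF.fixedPoint_isFixedPt
  have hTA : ∀ w, T (A w) = A (w + γ • A (C (A w))) := by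
    intro w; rw [hT, map_add, map_smul]
  have hTs : T (A ws) = A ws := by rw [hTA, hfix]
  refine ⟨?_, A ws, ?_, hTs, ?_, ?_⟩
  · intro x hx
    rw [hT]
    exact X.add_mem hx (X.smul_mem _ (hXmem _))
  · obtain ⟨v, hv⟩ := ws.2
    rw [← hv]; exact hXmem v
  · intro y hy hTy
    obtain ⟨v, rfl⟩ := (hX _).1 hy
    rw [hTA] at hTy
    have hv : A v ∈ LinearMap.range A := LinearMap.mem_range_self _ _
    have := hinj _ (F ⟨A v, hv⟩).2 _ hv hTy
    have h' : Function.IsFixedPt F ⟨A v, hv⟩ := Subtype.ext this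
    have := hF.fixedPoint_unique h'
    rw [hws, ← this]
  · intro x hx u w hu hw hAu hAw
    obtain ⟨v, rfl⟩ := (hX _).1 hx
    have hv : A v ∈ LinearMap.range A := LinearMap.mem_range_self _ _
    rw [← map_sub] at hAw
    have ew := hinj _ hw _ (Submodule.sub_mem _ hv ws.2) hAw
    rw [hTA, ← map_sub] at hAu
    have eu := hinj _ hu _ (Submodule.sub_mem _ (F ⟨A v, hv⟩).2 ws.2) hAu
    have := hest (A v) ws hv ws.2
    rw [hfix] at this
    rw [eu, ew]
    exact this
end

section
open scoped Kronecker

theorem eig_kron {N d : ℕ} (W : Matrix (Fin N) (Fin N) ℝ) (t : ℝ)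
    (v : EuclideanSpace ℝ (Fin N × Fin d)) (hv : v ≠ 0)
    (h : Matrix.toEuclideanLin (W ⊗ₖ (1 : Matrix (Fin d) (Fin d) ℝ)) v = t • v) :
    Module.End.HasEigenvalue (Matrix.toEuclideanLin W) t := by
  have : ∃ p : Fin N × Fin d, v p ≠ 0 := by
    by_contra hcon
    push Not at hcon
    exact hv (by ext p; simpa using hcon p)
  obtain ⟨⟨i, j⟩, hp⟩ := this
  refine Module.End.hasEigenvalue_of_hasEigenvector
    (x := WithLp.toLp 2 (fun k => v (k, j))) ⟨Module.End.mem_eigenspace_iff.2 ?_, ?_⟩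
  · ext k
    have := congrArg (fun z : EuclideanSpace ℝ (Fin N × Fin d) => z (k, j)) h
    simp only [Matrix.ofLp_toEuclideanLin_apply, Matrix.mulVec, dotProduct,
      Fintype.sum_prod_type, Matrix.kroneckerMap_apply, Matrix.one_apply] at this
    simp only [Matrix.ofLp_toEuclideanLin_apply, Matrix.mulVec, dotProduct]
    simpa using this
  · intro h0
    exact hp (congrArg (fun z : EuclideanSpace ℝ (Fin N) => z i) h0)

theorem spec_bounds {n : Type*} [Fintype n] [DecidableEq n] (S : Matrix n n ℝ) (hS : S.PosSemidef)
    (lp lm : ℝ)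
    (hlp : ∀ (t : ℝ) (v : EuclideanSpace ℝ n), v ≠ 0 → Matrix.toEuclideanLin (S * S) v = t • v →
      t ≠ 0 → lp ≤ t)
    (hlm : ∀ (t : ℝ) (v : EuclideanSpace ℝ n), v ≠ 0 → Matrix.toEuclideanLin (S * S) v = t • v →
      t ≤ lm) (v : EuclideanSpace ℝ n) (hv : v ∈ LinearMap.range (Matrix.toEuclideanLin S)) :
    lp * ‖v‖ ^ 2 ≤ ‖Matrix.toEuclideanLin S v‖ ^ 2 ∧
      ‖Matrix.toEuclideanLin S v‖ ^ 2 ≤ lm * ‖v‖ ^ 2 := by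
  set A := Matrix.toEuclideanLin S with hA
  have hsym : A.IsSymmetric := Matrix.isSymmetric_toEuclideanLin_iff.2 hS.1
  have hAA : ∀ x, Matrix.toEuclideanLin (S * S) x = A (A x) := by
    intro x
    simp only [hA, Matrix.toEuclideanLin_apply, Matrix.mulVec_mulVec]
  let bs := hS.1.eigenvectorBasis
  let ev := hS.1.eigenvalues
  have hb : ∀ j, A (bs j) = ev j • bs j := by
    intro j
    have := hS.1.mulVec_eigenvectorBasis j
    rw [hA, Matrix.toEuclideanLin_apply, this]; rfl
  have hbne : ∀ j, bs j ≠ 0 := fun j => bs.orthonormal.ne_zero j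
  have hb2 : ∀ j, Matrix.toEuclideanLin (S * S) (bs j) = (ev j * ev j) • bs j := by
    intro j; rw [hAA, hb, map_smul, hb, smul_smul]
  have hin : ∀ j x, ⟪bs j, A x⟫ = ev j * ⟪bs j, x⟫ := by
    intro j x
    rw [← hsym, hb, inner_smul_left]; rfl
  have n1 : ‖v‖ ^ 2 = ∑ j, ⟪bs j, v⟫ ^ 2 := by
    rw [← bs.sum_sq_norm_inner_right v]; simp
  have n2 : ‖A v‖ ^ 2 = ∑ j, (ev j * ev j) * ⟪bs j, v⟫ ^ 2 := by
    rw [← bs.sum_sq_norm_inner_right (A v)]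
    refine Finset.sum_congr rfl fun j _ => ?_
    rw [hin, Real.norm_eq_abs, sq_abs]; ring
  obtain ⟨y, rfl⟩ := hv
  rw [n1, n2, Finset.mul_sum, Finset.mul_sum]
  constructor
  · refine Finset.sum_le_sum fun j _ => ?_
    by_cases h0 : ev j = 0
    · rw [hin, h0]; simp
    · have := hlp _ _ (hbne j) (hb2 j) (mul_ne_zero h0 h0)
      gcongr
  · refine Finset.sum_le_sum fun j _ => ?_
    have := hlm _ _ (hbne j) (hb2 j)
    gcongr
end

theorem inner_blocks {N d : ℕ} (x y : EuclideanSpace ℝ (Fin N × Fin d)) :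
    ⟪x, y⟫ = ∑ i, ⟪blockGet x i, blockGet y i⟫ := by
  simp [PiLp.inner_apply, blockGet, Fintype.sum_prod_type]

theorem blockGet_sub {N d : ℕ} (x y : EuclideanSpace ℝ (Fin N × Fin d)) (i : Fin N) :
    blockGet (x - y) i = blockGet x i - blockGet y i := rfl

theorem blockGet_blockMk {N d : ℕ} (c : Fin N → EuclideanSpace ℝ (Fin d)) (i : Fin N) :
    blockGet (blockMk c) i = c i := rfl

theorem norm_blocks {N d : ℕ} (x : EuclideanSpace ℝ (Fin N × Fin d)) :
    ‖x‖ ^ 2 = ∑ i, ‖blockGet x i‖ ^ 2 := by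
  rw [← real_inner_self_eq_norm_sq, inner_blocks]
  simp only [real_inner_self_eq_norm_sq]

/-- Linear convergence of distributed dual decomposition over
a connected graph: with `W` the graph Laplacian, `W̄ = W ⊗ I_d`,
`λ⁺(W)` and `λ_max(W)` its smallest nonzero and largest eigenvalues,
step size `γ = 2Lμ/(μλ⁺(W) + Lλ_max(W))`, `κ(W) = λ_max(W)L/(μλ⁺(W))`,
`σ = 1 − 2/(κ(W)+1)`, `X = Im(W̄)`, and `‖x‖_M = ‖u‖₂` for the unique
`u ∈ Im(S)` with `Su = x` (`S` the psd square root of `W̄`), the dual update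
`T(x) = x + γW̄c(x)` maps `X` to `X`, has a unique fixed point `x*` in `X`, and
contracts: `‖T(x) − x*‖_M ≤ σ‖x − x*‖_M` for all `x ∈ X`. -/
theorem dual_decomposition_contraction {N d : ℕ} (hN : 2 ≤ N) (hd : 1 ≤ d)
    (G : SimpleGraph (Fin N)) [DecidableRel G.Adj] (hconn : G.Connected)
    (W : Matrix (Fin N) (Fin N) ℝ) (hW : W = G.lapMatrix ℝ)
    (lamPlus lamMax : ℝ)
    (hlp : Module.End.HasEigenvalue (Matrix.toEuclideanLin W) lamPlus)
    (hlp_pos : 0 < lamPlus)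
    (hlp_min : ∀ t : ℝ, t ≠ 0 →
      Module.End.HasEigenvalue (Matrix.toEuclideanLin W) t → lamPlus ≤ t)
    (hlm : Module.End.HasEigenvalue (Matrix.toEuclideanLin W) lamMax)
    (hlm_max : ∀ t : ℝ,
      Module.End.HasEigenvalue (Matrix.toEuclideanLin W) t → t ≤ lamMax)
    (Wbar : Matrix (Fin N × Fin d) (Fin N × Fin d) ℝ)
    (hWbar : Wbar = W ⊗ₖ (1 : Matrix (Fin d) (Fin d) ℝ))
    (μ L : ℝ) (hμ : 0 < μ) (hμL : μ ≤ L)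
    (f : Fin N → EuclideanSpace ℝ (Fin d) → ℝ)
    (g : Fin N → EuclideanSpace ℝ (Fin d) → EuclideanSpace ℝ (Fin d))
    (hconv : ∀ i, ConvexOn ℝ Set.univ (fun x => f i x - μ / 2 * ‖x‖ ^ 2))
    (hgrad : ∀ i x, HasGradientAt (f i) (g i x) x)
    (hlip : ∀ i x y, ‖g i x - g i y‖ ≤ L * ‖x - y‖)
    (cmap : Fin N → EuclideanSpace ℝ (Fin d) → EuclideanSpace ℝ (Fin d))
    (hcmap : ∀ i xi y, f i (cmap i xi) + ⟪cmap i xi, xi⟫ ≤ f i y + ⟪y, xi⟫)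
    (γ κW σ : ℝ)
    (hγ : γ = 2 * L * μ / (μ * lamPlus + L * lamMax))
    (hκW : κW = lamMax * L / (μ * lamPlus))
    (hσ : σ = 1 - 2 / (κW + 1))
    (T : EuclideanSpace ℝ (Fin N × Fin d) → EuclideanSpace ℝ (Fin N × Fin d))
    (hT : ∀ x, T x = x + γ •
      Matrix.toEuclideanLin Wbar (blockMk fun i => cmap i (blockGet x i)))
    (X : Submodule ℝ (EuclideanSpace ℝ (Fin N × Fin d)))
    (hX : X = LinearMap.range (Matrix.toEuclideanLin Wbar))
    (S : Matrix (Fin N × Fin d) (Fin N × Fin d) ℝ)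
    (hS : S.PosSemidef) (hSsq : S * S = Wbar) :
    (∀ x ∈ X, T x ∈ X) ∧
    ∃ xstar ∈ X, T xstar = xstar ∧ (∀ y ∈ X, T y = y → y = xstar) ∧
      (∀ x ∈ X, ∀ u w : EuclideanSpace ℝ (Fin N × Fin d),
        u ∈ LinearMap.range (Matrix.toEuclideanLin S) →
        w ∈ LinearMap.range (Matrix.toEuclideanLin S) →
        Matrix.toEuclideanLin S u = T x - xstar →
        Matrix.toEuclideanLin S w = x - xstar →
        ‖u‖ ≤ σ * ‖w‖) := by
  subst hWbar
  have hlpm : lamPlus ≤ lamMax := hlm_max _ hlp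
  have hlm0 : 0 < lamMax := by linarith
  have hL : 0 < L := by linarith
  have hsb := spec_bounds S hS lamPlus lamMax
    (fun t v hv h h0 => hlp_min t h0 (eig_kron W t v hv (by rw [← hSsq]; exact h)))
    (fun t v hv h => hlm_max t (eig_kron W t v hv (by rw [← hSsq]; exact h)))
  have hsym : (Matrix.toEuclideanLin S).IsSymmetric :=
    Matrix.isSymmetric_toEuclideanLin_iff.2 hS.1
  have hAA : ∀ x, Matrix.toEuclideanLin (W ⊗ₖ (1 : Matrix (Fin d) (Fin d) ℝ)) x
      = Matrix.toEuclideanLin S (Matrix.toEuclideanLin S x) := by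
    intro x
    rw [← hSsq]
    simp only [Matrix.toEuclideanLin_apply, Matrix.mulVec_mulVec]
  refine abstract_main (Matrix.toEuclideanLin S) hsym
    (fun x => blockMk fun i => cmap i (blockGet x i)) μ L lamPlus lamMax γ σ hμ hμL hlp_pos hlpm
    ?_ (fun v hv => (hsb v hv).1) (fun v hv => (hsb v hv).2) hγ ?_ T ?_ X ?_
  · intro x y
    rw [norm_blocks, norm_blocks, inner_blocks, Finset.mul_sum, Finset.mul_sum,
      ← Finset.sum_add_distrib, ← Finset.sum_neg_distrib]
    refine Finset.sum_le_sum fun i _ => ?_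
    simp only [blockGet_sub, blockGet_blockMk]
    have h := coco (hgrad i) μ L hμ hμL (hconv i) (hlip i) (cmap i (blockGet x i))
      (cmap i (blockGet y i))
    have hx := grad_at_min (hgrad i) _ _ (hcmap i (blockGet x i))
    have hy := grad_at_min (hgrad i) _ _ (hcmap i (blockGet y i))
    rw [hx, hy, show -blockGet x i - -blockGet y i = -(blockGet x i - blockGet y i) by abel,
      norm_neg, inner_neg_left] at h
    linarith
  · rw [hσ, hκW]
    field_simp
    ring
  · intro x
    rw [hT, hAA]
  · intro x
    rw [hX, LinearMap.mem_range]
    simp only [hAA]
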